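/- arXiv:1412.1332 — 3 statements merged into one kernel-verified Lean document; each statement's English description precedes it below -/
import Mathlib

section
/- Let d ≥ 1 and let n : ℝ × ℝ^d → ℝ and u : ℝ × ℝ^d → ℝ^d be C^∞ functions, ℤ^d-periodic in x, with n(t,x) > 0 everywhere, satisfying the continuity equation ∂_t n + div(n u) = 0 pointwise. Then for every t, the function t ↦ ∫_{T^d} |∇√n(t,x)|² dx is differentiable with derivative − ∫_{T^d} n(t,x) ∇( Δ√n / √n )(t,x) · u(t,x) dx. -/
open MeasureTheory

/-- Time derivative of `f : ℝ × ℝ^d → ℝ`. -/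
noncomputable def pdt {d : ℕ} (f : ℝ × (Fin d → ℝ) → ℝ) (p : ℝ × (Fin d → ℝ)) : ℝ :=
  fderiv ℝ f p (1, 0)

/-- The `i`-th spatial partial derivative of `f : ℝ × ℝ^d → ℝ`. -/
noncomputable def pdx {d : ℕ} (i : Fin d) (f : ℝ × (Fin d → ℝ) → ℝ)
    (p : ℝ × (Fin d → ℝ)) : ℝ :=
  fderiv ℝ f p (0, Pi.single i 1)

section PartialDerivatives

variable {d : ℕ} {f g : ℝ × (Fin d → ℝ) → ℝ}

theorem contDiff_pdt (hf : ContDiff ℝ (⊤ : ℕ∞) f) : ContDiff ℝ (⊤ : ℕ∞) (pdt f) :=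
  (hf.fderiv_right (m := (⊤ : ℕ∞)) (by simp)).clm_apply contDiff_const

theorem contDiff_pdx (i : Fin d) (hf : ContDiff ℝ (⊤ : ℕ∞) f) :
    ContDiff ℝ (⊤ : ℕ∞) (pdx i f) :=
  (hf.fderiv_right (m := (⊤ : ℕ∞)) (by simp)).clm_apply contDiff_const

theorem differentiableAt_of_smooth (hf : ContDiff ℝ (⊤ : ℕ∞) f) (p : ℝ × (Fin d → ℝ)) :
    DifferentiableAt ℝ f p :=
  (hf.differentiable (by simp)).differentiableAt

theorem pdx_add (i : Fin d) {p : ℝ × (Fin d → ℝ)} (hf : DifferentiableAt ℝ f p)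
    (hg : DifferentiableAt ℝ g p) :
    pdx i (fun q => f q + g q) p = pdx i f p + pdx i g p := by
  simp [pdx, fderiv_fun_add hf hg]

theorem pdx_mul (i : Fin d) {p : ℝ × (Fin d → ℝ)} (hf : DifferentiableAt ℝ f p)
    (hg : DifferentiableAt ℝ g p) :
    pdx i (fun q => f q * g q) p = f p * pdx i g p + g p * pdx i f p := by
  simp [pdx, fderiv_fun_mul hf hg]

theorem pdt_mul {p : ℝ × (Fin d → ℝ)} (hf : DifferentiableAt ℝ f p)
    (hg : DifferentiableAt ℝ g p) :
    pdt (fun q => f q * g q) p = f p * pdt g p + g p * pdt f p := by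
  simp [pdt, fderiv_fun_mul hf hg]

theorem periodic_pdt {c : ℝ × (Fin d → ℝ)} (hf : Function.Periodic f c) :
    Function.Periodic (pdt f) c := by
  intro p
  simp only [pdt, ← fderiv_comp_add_right, hf _]

theorem periodic_pdx (i : Fin d) {c : ℝ × (Fin d → ℝ)} (hf : Function.Periodic f c) :
    Function.Periodic (pdx i f) c := by
  intro p
  simp only [pdx, ← fderiv_comp_add_right, hf _]

theorem pdt_pdx_comm (i : Fin d) (hf : ContDiff ℝ (⊤ : ℕ∞) f) (p : ℝ × (Fin d → ℝ)) :
    pdt (pdx i f) p = pdx i (pdt f) p := by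
  have h2 : DifferentiableAt ℝ (fderiv ℝ f) p :=
    ((hf.fderiv_right (m := (⊤ : ℕ∞)) (by simp)).differentiable (by simp)).differentiableAt
  have hsymm : IsSymmSndFDerivAt ℝ f p :=
    hf.contDiffAt.isSymmSndFDerivAt (by
      rw [minSmoothness_of_isRCLikeNormedField]
      exact WithTop.coe_le_coe.2 le_top)
  have key (v w : ℝ × (Fin d → ℝ)) :
      fderiv ℝ (fun q => fderiv ℝ f q v) p w = fderiv ℝ (fderiv ℝ f) p w v := by
    rw [fderiv_clm_apply h2 (differentiableAt_const v)]
    simp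
  change fderiv ℝ (fun q => fderiv ℝ f q (0, Pi.single i 1)) p (1, 0) =
    fderiv ℝ (fun q => fderiv ℝ f q (1, 0)) p (0, Pi.single i 1)
  rw [key, key]
  exact hsymm _ _

theorem hasDerivAt_time (hf : ContDiff ℝ (⊤ : ℕ∞) f) (t : ℝ) (x : Fin d → ℝ) :
    HasDerivAt (fun s => f (s, x)) (pdt f (t, x)) t :=
  (differentiableAt_of_smooth hf (t, x)).hasFDerivAt.comp_hasDerivAt t
    ((hasDerivAt_id t).prodMk (hasDerivAt_const t x))

theorem hasFDerivAt_space (hf : ContDiff ℝ (⊤ : ℕ∞) f) (t : ℝ) (x : Fin d → ℝ) :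
    HasFDerivAt (fun y => f (t, y))
      ((fderiv ℝ f (t, x)).comp (ContinuousLinearMap.inr ℝ ℝ (Fin d → ℝ))) x :=
  (differentiableAt_of_smooth hf (t, x)).hasFDerivAt.comp x (hasFDerivAt_prodMk_right t x)

/-- The integral over the unit cube of the spatial divergence of a periodic field vanishes. -/
theorem integral_divergence_eq_zero_of_periodic (F : Fin d → ℝ × (Fin d → ℝ) → ℝ)
    (hF : ∀ i, ContDiff ℝ (⊤ : ℕ∞) (F i))
    (hper : ∀ i, Function.Periodic (F i) (0, Pi.single i 1)) (t : ℝ) :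
    ∫ x in Set.Icc (0 : Fin d → ℝ) 1, ∑ i, pdx i (F i) (t, x) = 0 := by
  cases d with
  | zero => simp
  | succ m =>
    have h := integral_divergence_of_hasFDerivAt_off_countable'
      (0 : Fin (m + 1) → ℝ) 1 zero_le_one (fun i x => F i (t, x))
      (fun i x => (fderiv ℝ (F i) (t, x)).comp (ContinuousLinearMap.inr ℝ ℝ (Fin (m + 1) → ℝ)))
      ∅ Set.countable_empty
      (fun i => ((hF i).continuous.comp (by fun_prop)).continuousOn)
      (fun x _ i => hasFDerivAt_space (hF i) t x)
      (by
        refine ContinuousOn.integrableOn_compact isCompact_Icc (Continuous.continuousOn ?_)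
        refine continuous_finsetSum _ fun i _ => ?_
        exact (contDiff_pdx i (hF i)).continuous.comp (by fun_prop))
    refine Eq.trans h (Finset.sum_eq_zero fun i _ => sub_eq_zero.2 ?_)
    refine integral_congr_ae (.of_forall fun x => ?_)
    have hx : ((t, Fin.insertNth i 1 x) : ℝ × (Fin (m + 1) → ℝ)) =
        (t, Fin.insertNth i 0 x) + (0, Pi.single i 1) := by
      ext j
      · simp
      · refine Fin.succAboveCases i ?_ (fun k => ?_) j <;> simp
    exact (congrArg (F i) hx).trans (hper i _)

/-- Differentiation in time under the integral sign over the unit cube. -/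
theorem hasDerivAt_integral_unitCube (hf : ContDiff ℝ (⊤ : ℕ∞) f) (t : ℝ) :
    HasDerivAt (fun s => ∫ x in Set.Icc (0 : Fin d → ℝ) 1, f (s, x))
      (∫ x in Set.Icc (0 : Fin d → ℝ) 1, pdt f (t, x)) t := by
  have hslice {g : ℝ × (Fin d → ℝ) → ℝ} (hg : Continuous g) (s : ℝ) :
      IntegrableOn (fun x => g (s, x)) (Set.Icc (0 : Fin d → ℝ) 1) :=
    (hg.comp (by fun_prop : Continuous fun x : Fin d → ℝ => (s, x))).continuousOn
      |>.integrableOn_compact isCompact_Icc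
  have hc := (contDiff_pdt hf).continuous
  obtain ⟨C, hC⟩ := ((isCompact_closedBall t 1).prod
    (isCompact_Icc : IsCompact (Set.Icc (0 : Fin d → ℝ) 1))).exists_bound_of_continuousOn
      hc.continuousOn
  refine (hasDerivAt_integral_of_dominated_loc_of_deriv_le (bound := fun _ => C)
    (F := fun s x => f (s, x)) (F' := fun s x => pdt f (s, x))
    (Metric.closedBall_mem_nhds t one_pos)
    (.of_forall fun s => (hslice hf.continuous s).aestronglyMeasurable)
    (hslice hf.continuous t) (hslice hc t).aestronglyMeasurable ?_ ?_ ?_).2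
  · exact (ae_restrict_mem measurableSet_Icc).mono fun x hx s hs => hC (s, x) ⟨hs, hx⟩
  · exact integrableOn_const (isCompact_Icc.measure_lt_top.ne)
  · exact .of_forall fun x s _ => hasDerivAt_time hf s x

/-- If `f²` satisfies the continuity equation with velocity `u`, then the time derivative of
`|∇f|²` equals `-f² ∇(Δf / f) · u` up to a divergence. -/
theorem pdt_sum_pdx_sq_eq (u : ℝ × (Fin d → ℝ) → Fin d → ℝ)
    (hf : ContDiff ℝ (⊤ : ℕ∞) f) (hg : ContDiff ℝ (⊤ : ℕ∞) g)
    (hu : ∀ i, ContDiff ℝ (⊤ : ℕ∞) fun q => u q i)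
    (hfg : ∀ q, g q * f q = ∑ j, pdx j (pdx j f) q)
    (hcont : ∀ p, pdt (fun q => f q * f q) p +
      ∑ j, pdx j (fun q => f q * f q * u q j) p = 0) (p : ℝ × (Fin d → ℝ)) :
    pdt (fun q => ∑ i, pdx i f q ^ 2) p =
      (∑ i, pdx i (fun q => 2 * pdt f q * pdx i f q + g q * (f q * f q * u q i)) p) -
        ∑ i, f p * f p * pdx i g p * u p i := by
  have D {h : ℝ × (Fin d → ℝ) → ℝ} (hh : ContDiff ℝ (⊤ : ℕ∞) h) : DifferentiableAt ℝ h p :=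
    differentiableAt_of_smooth hh p
  have hft := contDiff_pdt hf
  have hfx (i : Fin d) := contDiff_pdx i hf
  have hleft : pdt (fun q => ∑ i, pdx i f q ^ 2) p =
      ∑ i, 2 * pdx i f p * pdx i (pdt f) p := by
    simp only [← pdt_pdx_comm _ hf p]
    simp only [pdt]
    rw [fderiv_fun_sum (A := fun i q => pdx i f q ^ 2) fun i _ => (D (hfx i)).pow 2]
    simp [fderiv_fun_pow 2 (D (hfx _))]
  have hdiv (i : Fin d) :
      pdx i (fun q => 2 * pdt f q * pdx i f q + g q * (f q * f q * u q i)) p =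
        2 * pdx i f p * pdx i (pdt f) p + f p * f p * pdx i g p * u p i +
          (2 * pdt f p * pdx i (pdx i f) p + g p * pdx i (fun q => f q * f q * u q i) p) := by
    have h2 : pdx i (fun q => 2 * pdt f q) p = 2 * pdx i (pdt f) p := by
      simp [pdx, fderiv_const_mul (D hft)]
    rw [pdx_add i (D ((contDiff_const.mul hft).mul (hfx i)))
        (D (hg.mul ((hf.mul hf).mul (hu i)))),
      pdx_mul i (D (contDiff_const.mul hft)) (D (hfx i)),
      pdx_mul i (D hg) (D ((hf.mul hf).mul (hu i))), h2]
    ring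
  have hp := hcont p
  rw [pdt_mul (D hf) (D hf)] at hp
  rw [hleft, Finset.sum_congr rfl fun i _ => hdiv i]
  simp only [Finset.sum_add_distrib, ← Finset.mul_sum]
  rw [← hfg p]
  linear_combination -g p * hp

end PartialDerivatives

/-- For smooth `ℤ^d`-periodic-in-`x` `n > 0`, `u` satisfying `∂_t n + div(n u) = 0`,
the quantum energy `t ↦ ∫_{T^d} |∇√n|²` is differentiable with derivative
`−∫_{T^d} n ∇(Δ√n/√n) · u`. -/
theorem quantum_energy_derivative (d : ℕ) (hd : 1 ≤ d)
    (n : ℝ × (Fin d → ℝ) → ℝ) (u : ℝ × (Fin d → ℝ) → Fin d → ℝ)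
    (hn : ContDiff ℝ (⊤ : ℕ∞) n) (hu : ContDiff ℝ (⊤ : ℕ∞) u)
    (hpos : ∀ p, 0 < n p)
    (hnper : ∀ (z : Fin d → ℤ) (t : ℝ) (x : Fin d → ℝ),
      n (t, x + fun i => (z i : ℝ)) = n (t, x))
    (huper : ∀ (z : Fin d → ℤ) (t : ℝ) (x : Fin d → ℝ),
      u (t, x + fun i => (z i : ℝ)) = u (t, x))
    (hcont : ∀ p, pdt n p + ∑ j : Fin d, pdx j (fun q => n q * u q j) p = 0) :
    ∀ t : ℝ,
      HasDerivAt
        (fun s => ∫ x in Set.Icc (0 : Fin d → ℝ) 1,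
          ∑ i : Fin d, (pdx i (fun q => Real.sqrt (n q)) (s, x)) ^ 2)
        (-∫ x in Set.Icc (0 : Fin d → ℝ) 1, ∑ i : Fin d,
          n (t, x) *
            pdx i (fun q =>
              (∑ j : Fin d, pdx j (pdx j (fun r => Real.sqrt (n r))) q)
                / Real.sqrt (n q)) (t, x)
            * u (t, x) i) t := by
  intro t
  set S : ℝ × (Fin d → ℝ) → ℝ := fun q => Real.sqrt (n q) with hS
  have hSpos (q) : S q ≠ 0 := (Real.sqrt_pos.2 (hpos q)).ne'
  have hSS : n = fun q => S q * S q := funext fun q => (Real.mul_self_sqrt (hpos q).le).symm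
  have hSsm : ContDiff ℝ (⊤ : ℕ∞) S := hn.sqrt fun q => (hpos q).ne'
  set Q : ℝ × (Fin d → ℝ) → ℝ := fun q => (∑ j, pdx j (pdx j S) q) / S q with hQ
  have hQsm : ContDiff ℝ (⊤ : ℕ∞) Q :=
    (ContDiff.sum fun j _ => contDiff_pdx j (contDiff_pdx j hSsm)).div hSsm hSpos
  have husm (i : Fin d) : ContDiff ℝ (⊤ : ℕ∞) fun q => u q i := contDiff_pi.1 hu i
  have hcast (i : Fin d) :
      (Pi.single i 1 : Fin d → ℝ) = fun j => ((Pi.single i 1 : Fin d → ℤ) j : ℝ) := by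
    ext j
    simp [Pi.single_apply]
  have hSper (i : Fin d) : Function.Periodic S (0, Pi.single i 1) := fun p => by
    simp only [hS, hcast, Prod.add_def, add_zero, hnper]
  have huper' (i : Fin d) : Function.Periodic u (0, Pi.single i 1) := fun p => by
    simp only [hcast, Prod.add_def, add_zero, huper]
  have hQper (i : Fin d) : Function.Periodic Q (0, Pi.single i 1) := fun p => by
    simp only [hQ, hSper i p, periodic_pdx _ (periodic_pdx _ (hSper i)) p]
  set F : Fin d → ℝ × (Fin d → ℝ) → ℝ :=
    fun i q => 2 * pdt S q * pdx i S q + Q q * (S q * S q * u q i) with hF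
  have hFsm (i : Fin d) : ContDiff ℝ (⊤ : ℕ∞) (F i) :=
    ((contDiff_const.mul (contDiff_pdt hSsm)).mul (contDiff_pdx i hSsm)).add
      (hQsm.mul ((hSsm.mul hSsm).mul (husm i)))
  have hFper (i : Fin d) : Function.Periodic (F i) (0, Pi.single i 1) := fun p => by
    simp only [hF, hSper i p, hQper i p, huper' i p, periodic_pdt (hSper i) p,
      periodic_pdx i (hSper i) p]
  have hint {G : ℝ × (Fin d → ℝ) → ℝ} (hG : ContDiff ℝ (⊤ : ℕ∞) G) :
      IntegrableOn (fun x => G (t, x)) (Set.Icc (0 : Fin d → ℝ) 1) :=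
    (hG.continuous.comp (by fun_prop : Continuous fun x : Fin d → ℝ => (t, x))).continuousOn
      |>.integrableOn_compact isCompact_Icc
  clear_value S
  subst hSS
  convert hasDerivAt_integral_unitCube (f := fun q => ∑ i, pdx i S q ^ 2)
    (ContDiff.sum fun i _ => (contDiff_pdx i hSsm).pow 2) t using 1
  simp only [pdt_sum_pdx_sq_eq u hSsm hQsm husm
    (fun q => div_mul_cancel₀ _ (hSpos q)) hcont]
  rw [integral_sub (hint (ContDiff.sum fun i _ => contDiff_pdx i (hFsm i)))
    (hint (ContDiff.sum fun i _ =>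
      ((hSsm.mul hSsm).mul (contDiff_pdx i hQsm)).mul (husm i))),
    integral_divergence_eq_zero_of_periodic F hFsm hFper t, zero_sub]
end

section
/- (Energy dissipation identity) Let d ≥ 1, ν, ε > 0, γ > 1, and let H_c : ℝ → ℝ be C² and p_c : ℝ → ℝ be C¹ with p_c'(s) = s H_c''(s) for all s > 0. Let n : ℝ × ℝ^d → ℝ and u : ℝ × ℝ^d → ℝ^d be C^∞, ℤ^d-periodic in x, with n(t,x) > 0 everywhere, satisfying pointwise the continuity equation ∂_t n + div(n u) = 0 and the momentum equation ∂_t (n u_i) + Σ_j ∂_j (n u_j u_i) + ∂_i ( n^γ + p_c(n) ) − 2 ε² n ∂_i( Δ√n / √n ) = 2 ν Σ_j ∂_j ( n D(u)_{ij} ) for each i. Then for every t, the total energy t ↦ ∫_{T^d} ( n|u|²/2 + n^γ/(γ−1) + H_c(n) + 2 ε² |∇√n|² ) dx is differentiable with derivative − 2 ν ∫_{T^d} n Σ_{i,j} ( D(u)_{ij} )² dx, where D(u)_{ij} = (∂_i u_j + ∂_j u_i)/2. -/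
open MeasureTheory

theorem hasDerivAt_line {E : Type*} [NormedAddCommGroup E] [NormedSpace ℝ E] {f : E → ℝ} {p : E}
    (hf : DifferentiableAt ℝ f p) (v : E) :
    HasDerivAt (fun s : ℝ => f (p + s • v)) (fderiv ℝ f p v) 0 :=
  hf.hasFDerivAt.hasLineDerivAt v

theorem fderiv_apply_eq_of_hasDerivAt_line {E : Type*} [NormedAddCommGroup E] [NormedSpace ℝ E]
    {f : E → ℝ} {p v : E} {c : ℝ} (hf : DifferentiableAt ℝ f p)
    (h : HasDerivAt (fun s : ℝ => f (p + s • v)) c 0) : fderiv ℝ f p v = c :=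
  (hasDerivAt_line hf v).unique h

theorem fderiv_apply_mul {E : Type*} [NormedAddCommGroup E] [NormedSpace ℝ E]
    {f g : E → ℝ} {p : E} (hf : DifferentiableAt ℝ f p) (hg : DifferentiableAt ℝ g p) (v : E) :
    fderiv ℝ (fun q => f q * g q) p v = fderiv ℝ f p v * g p + f p * fderiv ℝ g p v := by
  rw [fderiv_fun_mul hf hg]
  simp
  ring

theorem fderiv_apply_comp {E : Type*} [NormedAddCommGroup E] [NormedSpace ℝ E]
    {φ : ℝ → ℝ} {f : E → ℝ} {p : E} {c : ℝ} (hφ : HasDerivAt φ c (f p))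
    (hf : DifferentiableAt ℝ f p) (v : E) :
    fderiv ℝ (fun q => φ (f q)) p v = c * fderiv ℝ f p v := by
  have := (hφ.comp_hasFDerivAt p hf.hasFDerivAt).fderiv
  change fderiv ℝ (φ ∘ f) p v = _
  rw [this]
  simp

theorem periodic_fderiv_apply {E : Type*} [NormedAddCommGroup E] [NormedSpace ℝ E]
    {f : E → ℝ} {a : E} (hf : Function.Periodic f a) (v : E) :
    Function.Periodic (fun q => fderiv ℝ f q v) a := by
  intro p
  have h : (fun q => f (q + a)) = f := funext hf
  change fderiv ℝ f (p + a) v = fderiv ℝ f p v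
  rw [← fderiv_comp_add_right, h]

theorem fderiv_apply_comm {E : Type*} [NormedAddCommGroup E] [NormedSpace ℝ E]
    {f : E → ℝ} (hf : ContDiff ℝ 2 f) (p v w : E) :
    fderiv ℝ (fun q => fderiv ℝ f q v) p w = fderiv ℝ (fun q => fderiv ℝ f q w) p v := by
  have hd : Differentiable ℝ (fderiv ℝ f) :=
    (hf.fderiv_right (m := 1) (by norm_num)).differentiable (by norm_num)
  have hs : IsSymmSndFDerivAt ℝ f p := hf.contDiffAt.isSymmSndFDerivAt (by simp)
  have h : ∀ v w : E, fderiv ℝ (fun q => fderiv ℝ f q v) p w = fderiv ℝ (fderiv ℝ f) p w v := by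
    intro v w
    rw [fderiv_clm_apply (hd p) (differentiableAt_const v)]
    simp
  rw [h, h, hs.eq]

theorem contDiff_fderiv_apply_infty {E : Type*} [NormedAddCommGroup E] [NormedSpace ℝ E]
    {f : E → ℝ} (hf : ContDiff ℝ (⊤ : ℕ∞) f) (v : E) :
    ContDiff ℝ (⊤ : ℕ∞) (fun q => fderiv ℝ f q v) :=
  (hf.fderiv_right (m := (⊤ : ℕ∞)) (by norm_cast)).clm_apply contDiff_const

/-- The integral over the unit cube of the divergence of a periodic `C¹` field vanishes. -/
theorem integral_sum_fderiv_eq_zero_of_periodic {m : ℕ}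
    (F : Fin (m + 1) → (Fin (m + 1) → ℝ) → ℝ) (hF : ∀ i, ContDiff ℝ 1 (F i))
    (hper : ∀ i, Function.Periodic (F i) (Pi.single i 1)) :
    ∫ x in Set.Icc (0 : Fin (m + 1) → ℝ) 1, ∑ i, fderiv ℝ (F i) x (Pi.single i 1) = 0 := by
  rw [integral_divergence_of_hasFDerivAt_off_countable' 0 1 zero_le_one F
    (fun i x => fderiv ℝ (F i) x) ∅ Set.countable_empty (fun i => (hF i).continuous.continuousOn)
    (fun x _ i => ((hF i).differentiable (by norm_num) x).hasFDerivAt)]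
  · refine Finset.sum_eq_zero fun i _ => ?_
    rw [sub_eq_zero]
    refine integral_congr_ae (Filter.Eventually.of_forall fun x => ?_)
    have h : (i.insertNth ((1 : Fin (m + 1) → ℝ) i) x : Fin (m + 1) → ℝ)
        = i.insertNth ((0 : Fin (m + 1) → ℝ) i) x + Pi.single i 1 := by
      ext j
      refine Fin.succAboveCases i ?_ (fun k => ?_) j <;> simp
    change F i _ = F i _
    rw [h, hper i]
  · refine (continuous_finsetSum _ fun i _ => ?_).continuousOn.integrableOn_compact isCompact_Icc
    exact ((hF i).continuous_fderiv (by norm_num)).clm_apply continuous_const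

theorem integral_sum_pdx_eq_zero {d : ℕ} (hd : 1 ≤ d) (F : Fin d → ℝ × (Fin d → ℝ) → ℝ)
    (hF : ∀ i, ContDiff ℝ 1 (F i))
    (hper : ∀ i, Function.Periodic (F i) (0, Pi.single i 1)) (t : ℝ) :
    ∫ x in Set.Icc (0 : Fin d → ℝ) 1, ∑ i, pdx i (F i) (t, x) = 0 := by
  obtain ⟨m, rfl⟩ : ∃ m, d = m + 1 := ⟨d - 1, by omega⟩
  rw [← integral_sum_fderiv_eq_zero_of_periodic (fun i x => F i (t, x))
    (fun i => (hF i).comp (contDiff_const.prodMk contDiff_id))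
    (fun i x => by simpa using hper i (t, x))]
  refine integral_congr_ae (Filter.Eventually.of_forall fun x => ?_)
  refine Finset.sum_congr rfl fun i _ => ?_
  have h := (((hF i).differentiable (by norm_num) (t, x)).hasFDerivAt.comp x
    (hasFDerivAt_prodMk_right t x)).fderiv
  change fderiv ℝ (F i) (t, x) _ = fderiv ℝ (F i ∘ Prod.mk t) x _
  rw [h]
  simp

/-- Differentiation under the integral over the unit cube for a `C¹` integrand. -/
theorem hasDerivAt_integral_Icc_of_contDiff {d : ℕ} {e : ℝ × (Fin d → ℝ) → ℝ}
    (he : ContDiff ℝ 1 e) (t : ℝ) :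
    HasDerivAt (fun s => ∫ x in Set.Icc (0 : Fin d → ℝ) 1, e (s, x))
      (∫ x in Set.Icc (0 : Fin d → ℝ) 1, pdt e (t, x)) t := by
  have hc : Continuous (pdt e) :=
    (he.continuous_fderiv (by norm_num)).clm_apply continuous_const
  obtain ⟨C, hC⟩ := ((isCompact_Icc (a := t - 1) (b := t + 1)).prod
    (isCompact_Icc (a := (0 : Fin d → ℝ)) (b := 1))).exists_bound_of_continuousOn hc.continuousOn
  have hint : ∀ {g : ℝ × (Fin d → ℝ) → ℝ}, Continuous g → ∀ s : ℝ,
      Integrable (fun x => g (s, x)) (volume.restrict (Set.Icc (0 : Fin d → ℝ) 1)) :=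
    fun hg s => (hg.comp (Continuous.prodMk_right s)).continuousOn.integrableOn_compact
      isCompact_Icc
  refine (hasDerivAt_integral_of_dominated_loc_of_deriv_le (F' := fun s x => pdt e (s, x))
    (bound := fun _ => C) (Icc_mem_nhds (by linarith) (by linarith) : Set.Icc (t - 1) (t + 1) ∈ _)
    (Filter.Eventually.of_forall fun s => (hint he.continuous s).aestronglyMeasurable)
    (hint he.continuous t) (hint hc t).aestronglyMeasurable ?_ ?_ ?_).2
  · filter_upwards [ae_restrict_mem measurableSet_Icc] with x hx s hs
    exact hC (s, x) ⟨hs, hx⟩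
  · exact integrableOn_const isCompact_Icc.measure_ne_top
  · refine Filter.Eventually.of_forall fun x s _ => ?_
    have h := ((he.differentiable (by norm_num) (s, x)).hasFDerivAt.comp s
      (hasFDerivAt_prodMk_left s x)).hasDerivAt
    simpa [pdt, Function.comp_def] using h

theorem energy_balance_algebra {d : ℕ} (ν ε n N h B m Mt : ℝ)
    (U Ut W G Bx mx mxt mxx : Fin d → ℝ) (X S : Fin d → Fin d → ℝ)
    (hN : N + ∑ j, W j = 0)
    (hmom : ∀ i, (N * U i + n * Ut i) + (∑ j, (W j * U i + n * U j * X j i)) + n * G i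
      - 2 * ε ^ 2 * n * Bx i = 2 * ν * ∑ j, S i j)
    (hB : ∑ j, mxx j = B * m) (hm : N = 2 * m * Mt) :
    N * (∑ i, U i ^ 2) / 2 + n * (∑ i, U i * Ut i) + h * N + 2 * ε ^ 2 * ∑ j, 2 * (mx j * mxt j)
      = -(2 * ν) * (n * ∑ i, ∑ j, ((X i j + X j i) / 2) ^ 2)
        + ∑ j, (-(W j * ((∑ i, U i ^ 2) / 2) + n * U j * ∑ i, U i * X j i)
          - (W j * h + n * U j * G j) + 2 * ε ^ 2 * (W j * B + n * U j * Bx j)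
          + 4 * ε ^ 2 * (mxx j * Mt + mx j * mxt j)
          + 2 * ν * ∑ i, (X j i * (n * ((X i j + X j i) / 2)) + U i * S i j)) := by
  have hW : ∑ j, W j = -N := by linarith
  have hD : ∑ j, ∑ i, X j i * (n * ((X i j + X j i) / 2))
      = n * ∑ i, ∑ j, ((X i j + X j i) / 2) ^ 2 := by
    have h1 : ∑ j, ∑ i, X j i * (n * ((X i j + X j i) / 2))
        = ∑ j, ∑ i, X i j * (n * ((X i j + X j i) / 2)) := by
      rw [Finset.sum_comm]
      refine Finset.sum_congr rfl fun i _ => Finset.sum_congr rfl fun j _ => ?_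
      ring
    have h2 : ∑ j, ∑ i, X j i * (n * ((X i j + X j i) / 2))
        + ∑ j, ∑ i, X i j * (n * ((X i j + X j i) / 2))
        = 2 * (n * ∑ i, ∑ j, ((X i j + X j i) / 2) ^ 2) := by
      simp only [Finset.mul_sum, ← Finset.sum_add_distrib]
      refine Finset.sum_congr rfl fun i _ => Finset.sum_congr rfl fun j _ => ?_
      ring
    linarith
  have hmom' : ∀ i, n * Ut i = -(∑ j, n * U j * X j i) - n * G i + 2 * ε ^ 2 * n * Bx i
      + 2 * ν * ∑ j, S i j := by
    intro i
    have := hmom i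
    rw [Finset.sum_add_distrib, ← Finset.sum_mul, hW] at this
    linarith
  have hK : n * (∑ i, U i * Ut i) = -(∑ j, n * U j * ∑ i, U i * X j i) - ∑ j, n * U j * G j
      + 2 * ε ^ 2 * (∑ j, n * U j * Bx j) + 2 * ν * ∑ j, ∑ i, U i * S i j := by
    have h1 : n * (∑ i, U i * Ut i) = ∑ i, U i * (n * Ut i) := by
      rw [Finset.mul_sum]
      exact Finset.sum_congr rfl fun i _ => by ring
    have h2 : ∑ j, n * U j * ∑ i, U i * X j i = ∑ i, U i * ∑ j, n * U j * X j i := by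
      simp only [Finset.mul_sum]
      rw [Finset.sum_comm]
      refine Finset.sum_congr rfl fun i _ => Finset.sum_congr rfl fun j _ => ?_
      ring
    have h3 : ∑ j, ∑ i, U i * S i j = ∑ i, U i * ∑ j, S i j := by
      simp only [Finset.mul_sum]
      rw [Finset.sum_comm]
    rw [h1, h2, h3]
    have h4 : ∀ i, U i * (n * Ut i) = -(U i * ∑ j, n * U j * X j i) - n * U i * G i
        + 2 * ε ^ 2 * (n * U i * Bx i) + 2 * ν * (U i * ∑ j, S i j) := by
      intro i
      rw [hmom' i]
      ring
    simp only [h4, Finset.sum_add_distrib, Finset.sum_sub_distrib, Finset.sum_neg_distrib,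
      ← Finset.mul_sum]
  simp only [Finset.sum_add_distrib, Finset.sum_sub_distrib, Finset.sum_neg_distrib,
    ← Finset.mul_sum, ← Finset.sum_mul, hW, hD, hB]
  rw [hK, hm]
  ring

/-- Energy dissipation identity for the quantum Navier–Stokes system: the total energy
`∫_{T^d} ( n|u|²/2 + n^γ/(γ−1) + H_c(n) + 2ε²|∇√n|² )` is differentiable in time with
derivative `−2ν ∫_{T^d} n |D(u)|²`. -/
theorem energy_dissipation (d : ℕ) (hd : 1 ≤ d) (ν ε γ : ℝ)
    (hν : 0 < ν) (hε : 0 < ε) (hγ : 1 < γ)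
    (H_c : ℝ → ℝ) (hHc : ContDiff ℝ 2 H_c)
    (p_c : ℝ → ℝ) (hpc : ContDiff ℝ 1 p_c)
    (hpHc : ∀ s : ℝ, 0 < s → deriv p_c s = s * deriv (deriv H_c) s)
    (n : ℝ × (Fin d → ℝ) → ℝ) (u : ℝ × (Fin d → ℝ) → Fin d → ℝ)
    (hn : ContDiff ℝ (⊤ : ℕ∞) n) (hu : ContDiff ℝ (⊤ : ℕ∞) u)
    (hpos : ∀ p, 0 < n p)
    (hnper : ∀ (z : Fin d → ℤ) (t : ℝ) (x : Fin d → ℝ),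
      n (t, x + fun i => (z i : ℝ)) = n (t, x))
    (huper : ∀ (z : Fin d → ℤ) (t : ℝ) (x : Fin d → ℝ),
      u (t, x + fun i => (z i : ℝ)) = u (t, x))
    (hcont : ∀ p, pdt n p + ∑ j : Fin d, pdx j (fun q => n q * u q j) p = 0)
    (hmom : ∀ (p : ℝ × (Fin d → ℝ)) (i : Fin d),
      pdt (fun q => n q * u q i) p
        + (∑ j : Fin d, pdx j (fun q => n q * u q j * u q i) p)
        + pdx i (fun q => n q ^ γ + p_c (n q)) p
        - 2 * ε ^ 2 * n p *
            pdx i (fun q =>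
              (∑ j : Fin d, pdx j (pdx j (fun r => Real.sqrt (n r))) q)
                / Real.sqrt (n q)) p
        = 2 * ν * ∑ j : Fin d,
            pdx j (fun q => n q *
              ((pdx i (fun r => u r j) q + pdx j (fun r => u r i) q) / 2)) p) :
    ∀ t : ℝ,
      HasDerivAt
        (fun s => ∫ x in Set.Icc (0 : Fin d → ℝ) 1,
          (n (s, x) * (∑ i : Fin d, u (s, x) i ^ 2) / 2
            + n (s, x) ^ γ / (γ - 1)
            + H_c (n (s, x))
            + 2 * ε ^ 2 * ∑ i : Fin d, (pdx i (fun q => Real.sqrt (n q)) (s, x)) ^ 2))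
        (-(2 * ν) * ∫ x in Set.Icc (0 : Fin d → ℝ) 1,
          n (t, x) * ∑ i : Fin d, ∑ j : Fin d,
            ((pdx i (fun r => u r j) (t, x) + pdx j (fun r => u r i) (t, x)) / 2) ^ 2) t := by
  intro t
  have hn' : ∀ q, n q ≠ 0 := fun q => (hpos q).ne'
  obtain ⟨m, hm_def⟩ : ∃ m : ℝ × (Fin d → ℝ) → ℝ, m = fun r => Real.sqrt (n r) := ⟨_, rfl⟩
  have hm : ContDiff ℝ (⊤ : ℕ∞) m := hm_def ▸ hn.sqrt hn'
  have hmpos : ∀ q, m q ≠ 0 := fun q => by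
    rw [hm_def]
    exact (Real.sqrt_pos.2 (hpos q)).ne'
  have hmsq : ∀ q, n q = m q * m q := fun q => by
    rw [hm_def]
    exact (Real.mul_self_sqrt (hpos q).le).symm
  have hui : ∀ i, ContDiff ℝ (⊤ : ℕ∞) (fun q => u q i) := fun i => contDiff_pi.1 hu i
  have hX : ∀ i j, ContDiff ℝ (⊤ : ℕ∞) (pdx j (fun q => u q i)) :=
    fun i j => contDiff_fderiv_apply_infty (hui i) _
  have hmx : ∀ j, ContDiff ℝ (⊤ : ℕ∞) (pdx j m) := fun j => contDiff_fderiv_apply_infty hm _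
  have hmt : ContDiff ℝ (⊤ : ℕ∞) (pdt m) := contDiff_fderiv_apply_infty hm _
  have hmxx : ∀ j, ContDiff ℝ (⊤ : ℕ∞) (pdx j (pdx j m)) :=
    fun j => contDiff_fderiv_apply_infty (hmx j) _
  obtain ⟨B, hB_def⟩ : ∃ B : ℝ × (Fin d → ℝ) → ℝ,
    B = fun q => (∑ j : Fin d, pdx j (pdx j m) q) / m q := ⟨_, rfl⟩
  have hB : ContDiff ℝ (⊤ : ℕ∞) B := hB_def ▸ (ContDiff.sum fun j _ => hmxx j).div hm hmpos
  obtain ⟨S, hS_def⟩ : ∃ S : Fin d → Fin d → ℝ × (Fin d → ℝ) → ℝ,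
    S = fun i j q => n q * ((pdx i (fun r => u r j) q + pdx j (fun r => u r i) q) / 2) := ⟨_, rfl⟩
  have hS : ∀ i j, ContDiff ℝ (⊤ : ℕ∞) (S i j) := fun i j =>
    hS_def ▸ hn.mul (((hX j i).add (hX i j)).div_const 2)
  obtain ⟨h, h_def⟩ : ∃ h : ℝ × (Fin d → ℝ) → ℝ,
    h = fun q => γ / (γ - 1) * n q ^ (γ - 1) + deriv H_c (n q) := ⟨_, rfl⟩
  have hHc' : ContDiff ℝ 1 (deriv H_c) := ContDiff.deriv' (n := 1)
    (by simpa [one_add_one_eq_two] using hHc)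
  have hh : ContDiff ℝ 1 h := h_def ▸
    (contDiff_const.mul ((hn.of_le (by norm_cast)).rpow_const_of_ne hn')).add
      (hHc'.comp (hn.of_le (by norm_cast)))
  have hne : ((⊤ : ℕ∞) : WithTop ℕ∞) ≠ 0 := by norm_cast
  have hnd : Differentiable ℝ n := hn.differentiable hne
  have hud : ∀ i, Differentiable ℝ (fun q => u q i) := fun i => (hui i).differentiable hne
  have hwd : ∀ i, Differentiable ℝ (fun q => n q * u q i) := fun i => hnd.mul (hud i)
  have hmom' : ∀ (p : ℝ × (Fin d → ℝ)) (i : Fin d),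
      pdt (fun q => n q * u q i) p + (∑ j : Fin d, pdx j (fun q => n q * u q j * u q i) p)
        + pdx i (fun q => n q ^ γ + p_c (n q)) p - 2 * ε ^ 2 * n p * pdx i B p
        = 2 * ν * ∑ j : Fin d, pdx j (S i j) p := by
    subst hB_def hS_def hm_def
    exact hmom
  have hpress : ∀ p i, pdx i (fun q => n q ^ γ + p_c (n q)) p = n p * pdx i h p := by
    intro p i
    have h1 : HasDerivAt (fun s => s ^ γ + p_c s)
        (γ * n p ^ (γ - 1) + n p * deriv (deriv H_c) (n p)) (n p) := by
      rw [← hpHc _ (hpos p)]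
      exact (Real.hasDerivAt_rpow_const (Or.inl (hn' p))).add
        (hpc.differentiable (by norm_num) _).hasDerivAt
    have h2 : HasDerivAt (fun s => γ / (γ - 1) * s ^ (γ - 1) + deriv H_c s)
        (γ / (γ - 1) * ((γ - 1) * n p ^ (γ - 1 - 1)) + deriv (deriv H_c) (n p)) (n p) :=
      ((Real.hasDerivAt_rpow_const (Or.inl (hn' p))).const_mul _).add
        (hHc'.differentiable (by norm_num) _).hasDerivAt
    unfold pdx
    rw [fderiv_apply_comp h1 (hnd p), h_def, fderiv_apply_comp h2 (hnd p)]
    have h3 : n p * n p ^ (γ - 1 - 1) = n p ^ (γ - 1) := by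
      rw [mul_comm, ← Real.rpow_add_one (hn' p), sub_add_cancel]
    have h4 : γ - 1 ≠ 0 := by linarith
    rw [← h3]
    field_simp
  obtain ⟨e, he_def⟩ : ∃ e : ℝ × (Fin d → ℝ) → ℝ,
    e = fun q => n q * (∑ i : Fin d, u q i ^ 2) / 2 + n q ^ γ / (γ - 1) + H_c (n q)
      + 2 * ε ^ 2 * ∑ i : Fin d, (pdx i m q) ^ 2 := ⟨_, rfl⟩
  have he : ContDiff ℝ 1 e := by
    have h1 : ((1 : ℕ∞) : WithTop ℕ∞) ≤ ((⊤ : ℕ∞) : WithTop ℕ∞) := by norm_cast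
    rw [he_def]
    exact ((((hn.of_le h1).mul (ContDiff.sum fun i _ => ((hui i).of_le h1).pow 2)).div_const 2).add
      (((hn.of_le h1).rpow_const_of_ne hn').div_const _)).add
      ((hHc.of_le (by norm_num)).comp (hn.of_le h1)) |>.add
      (contDiff_const.mul (ContDiff.sum fun i _ => ((hmx i).of_le h1).pow 2))
  have hsq : ∀ (f : Fin d → ℝ × (Fin d → ℝ) → ℝ) (p v : ℝ × (Fin d → ℝ)),
      (∀ i, DifferentiableAt ℝ (f i) p) →
      HasDerivAt (fun s : ℝ => ∑ i, f i (p + s • v) ^ 2)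
        (2 * ∑ i, f i p * fderiv ℝ (f i) p v) 0 := by
    intro f p v hf
    refine (HasDerivAt.fun_sum (u := Finset.univ)
      fun i _ => (hasDerivAt_line (hf i) v).pow 2).congr_deriv ?_
    simp [Finset.mul_sum, mul_assoc]
  have hdte : ∀ p, pdt e p = pdt n p * (∑ i, u p i ^ 2) / 2
      + n p * (∑ i, u p i * pdt (fun q => u q i) p) + h p * pdt n p
      + 2 * ε ^ 2 * ∑ j, 2 * (pdx j m p * pdx j (pdt m) p) := by
    intro p
    have h1 : HasDerivAt (fun s => s ^ γ / (γ - 1) + H_c s) (h p) (n p) := by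
      rw [h_def]
      refine (((Real.hasDerivAt_rpow_const (Or.inl (hn' p))).div_const (γ - 1)).add
        (hHc.differentiable (by norm_num) _).hasDerivAt).congr_deriv ?_
      ring
    have h2 := fderiv_apply_comp h1 (hnd p) (1, 0)
    have h3 := hasDerivAt_line (h1.comp_hasFDerivAt p (hnd p).hasFDerivAt).differentiableAt (1, 0)
    have h4 := ((hasDerivAt_line (hnd p) (1, 0)).mul
      (hsq (fun i q => u q i) p (1, 0) fun i => hud i p)).div_const 2
    have h5 := (hsq (fun i => pdx i m) p (1, 0)
      fun i => (hmx i).differentiable hne p).const_mul (2 * ε ^ 2)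
    have h6 : ∀ j, fderiv ℝ (pdx j m) p (1, 0) = pdx j (pdt m) p := fun j =>
      fderiv_apply_comm (hm.of_le (by norm_cast)) p _ _
    refine fderiv_apply_eq_of_hasDerivAt_line (he.differentiable (by norm_num) p) ?_
    subst he_def
    refine (((h4.add h3).add h5).congr_deriv ?_).congr_of_eventuallyEq
      (Filter.Eventually.of_forall fun s => ?_)
    · simp only [Function.comp_def, h2, h6, zero_smul, add_zero, ← Finset.mul_sum]
      unfold pdt
      ring
    · simp only [Pi.add_apply, Pi.mul_apply, Function.comp_apply]
      ring
  obtain ⟨F, hF_def⟩ : ∃ F : Fin d → ℝ × (Fin d → ℝ) → ℝ,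
    F = fun j q => -(n q * u q j * ((∑ i, u q i ^ 2) / 2)) - n q * u q j * h q
      + 2 * ε ^ 2 * (n q * u q j * B q) + 4 * ε ^ 2 * (pdx j m q * pdt m q)
      + 2 * ν * ∑ i, u q i * S i j q := ⟨_, rfl⟩
  have hF : ∀ j, ContDiff ℝ 1 (F j) := by
    intro j
    have h1 : ((1 : ℕ∞) : WithTop ℕ∞) ≤ ((⊤ : ℕ∞) : WithTop ℕ∞) := by norm_cast
    have h2 := (hn.mul (hui j)).of_le h1
    rw [hF_def]
    exact ((((h2.mul ((ContDiff.sum fun i _ => ((hui i).of_le h1).pow 2).div_const 2)).neg.sub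
      (h2.mul hh)).add (contDiff_const.mul (h2.mul (hB.of_le h1)))).add
      (contDiff_const.mul (((hmx j).mul hmt).of_le h1))).add
      (contDiff_const.mul (ContDiff.sum fun i _ => ((hui i).mul (hS i j)).of_le h1))
  have hdF : ∀ j p, pdx j (F j) p
      = -(pdx j (fun q => n q * u q j) p * ((∑ i, u p i ^ 2) / 2)
          + n p * u p j * ∑ i, u p i * pdx j (fun q => u q i) p)
        - (pdx j (fun q => n q * u q j) p * h p + n p * u p j * pdx j h p)
        + 2 * ε ^ 2 * (pdx j (fun q => n q * u q j) p * B p + n p * u p j * pdx j B p)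
        + 4 * ε ^ 2 * (pdx j (pdx j m) p * pdt m p + pdx j m p * pdx j (pdt m) p)
        + 2 * ν * ∑ i, (pdx j (fun q => u q i) p * S i j p + u p i * pdx j (S i j) p) := by
    intro j p
    refine fderiv_apply_eq_of_hasDerivAt_line ((hF j).differentiable (by norm_num) p) ?_
    have h1 := hasDerivAt_line (hwd j p) (0, Pi.single j 1)
    have h2 := (hsq (fun i q => u q i) p (0, Pi.single j 1) fun i => hud i p).div_const 2
    have h3 := hasDerivAt_line (hh.differentiable (by norm_num) p) (0, Pi.single j 1)
    have h4 := hasDerivAt_line (hB.differentiable hne p) (0, Pi.single j 1)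
    have h5 := hasDerivAt_line ((hmx j).differentiable hne p) (0, Pi.single j 1)
    have h6 := hasDerivAt_line (hmt.differentiable hne p) (0, Pi.single j 1)
    have h7 := HasDerivAt.fun_sum (u := Finset.univ) fun i _ =>
      (hasDerivAt_line (hud i p) (0, Pi.single j 1)).mul
        (hasDerivAt_line ((hS i j).differentiable hne p) (0, Pi.single j 1))
    subst hF_def
    refine (((((h1.mul h2).neg.sub (h1.mul h3)).add ((h1.mul h4).const_mul (2 * ε ^ 2))).add
      ((h5.mul h6).const_mul (4 * ε ^ 2))).add (h7.const_mul (2 * ν))).congr_deriv ?_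
    simp only [zero_smul, add_zero]
    unfold pdx
    ring
  have hFper : ∀ j, Function.Periodic (F j) (0, Pi.single j 1) := by
    intro j
    obtain ⟨a, ha⟩ : ∃ a : ℝ × (Fin d → ℝ), a = (0, Pi.single j 1) := ⟨_, rfl⟩
    have hz : (fun i => ((Pi.single j 1 : Fin d → ℤ) i : ℝ)) = Pi.single j 1 := by
      ext i
      by_cases hij : i = j
      · subst hij
        simp
      · simp [hij]
    rw [← ha]
    have pn : Function.Periodic n a := by
      rintro ⟨s, x⟩
      rw [ha, ← hnper (Pi.single j 1) s x, hz]
      simp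
    have pu : Function.Periodic u a := by
      rintro ⟨s, x⟩
      rw [ha, ← huper (Pi.single j 1) s x, hz]
      simp
    have pui : ∀ i, Function.Periodic (fun q => u q i) a := fun i q => congrFun (pu q) i
    have pX : ∀ i k, Function.Periodic (pdx k (fun q => u q i)) a :=
      fun i k => periodic_fderiv_apply (pui i) _
    have pm : Function.Periodic m a := fun q => by simp only [hm_def, pn q]
    have pmx : ∀ k, Function.Periodic (pdx k m) a := fun k => periodic_fderiv_apply pm _
    have pmt : Function.Periodic (pdt m) a := periodic_fderiv_apply pm _
    have pmxx : ∀ k, Function.Periodic (pdx k (pdx k m)) a :=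
      fun k => periodic_fderiv_apply (pmx k) _
    intro q
    simp only [hF_def, h_def, hB_def, hS_def, pn q, pu q, pm q, pmt q, (pmx _) q, (pmxx _) q,
      (pX _ _) q]
  have hkey : ∀ p, pdt e p = -(2 * ν) * (n p * ∑ i : Fin d, ∑ j : Fin d,
      ((pdx i (fun r => u r j) p + pdx j (fun r => u r i) p) / 2) ^ 2) + ∑ j, pdx j (F j) p := by
    intro p
    rw [hdte p, energy_balance_algebra ν ε (n p) (pdt n p) (h p) (B p) (m p) (pdt m p) (u p)
      (fun i => pdt (fun q => u q i) p) (fun j => pdx j (fun q => n q * u q j) p)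
      (fun i => pdx i h p) (fun i => pdx i B p) (fun j => pdx j m p)
      (fun j => pdx j (pdt m) p) (fun j => pdx j (pdx j m) p)
      (fun i j => pdx i (fun q => u q j) p) (fun i j => pdx j (S i j) p) (hcont p) ?_ ?_ ?_]
    · simp only [hdF]
      rw [hS_def]
    · intro i
      have h1 := hmom' p i
      have h2 : pdt (fun q => n q * u q i) p = pdt n p * u p i + n p * pdt (fun q => u q i) p :=
        fderiv_apply_mul (hnd p) (hud i p) _
      have h3 : ∀ j, pdx j (fun q => n q * u q j * u q i) p
          = pdx j (fun q => n q * u q j) p * u p i + n p * u p j * pdx j (fun q => u q i) p :=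
        fun j => fderiv_apply_mul (hwd j p) (hud i p) _
      simpa only [hpress, h2, h3] using h1
    · rw [hB_def]
      exact (div_mul_cancel₀ _ (hmpos p)).symm
    · have h1 : pdt n p = pdt (fun q => m q * m q) p := by
        rw [show n = fun q => m q * m q from funext hmsq]
      have h2 : pdt (fun q => m q * m q) p = pdt m p * m p + m p * pdt m p :=
        fderiv_apply_mul (hm.differentiable hne p) (hm.differentiable hne p) _
      rw [h1, h2]
      ring
  have hcpd : ∀ (i : Fin d) {f : ℝ × (Fin d → ℝ) → ℝ}, ContDiff ℝ 1 f → Continuous (pdx i f) :=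
    fun i f hf => (hf.continuous_fderiv (by norm_num)).clm_apply continuous_const
  have hint : ∀ {g : ℝ × (Fin d → ℝ) → ℝ}, Continuous g →
      Integrable (fun x => g (t, x)) (volume.restrict (Set.Icc (0 : Fin d → ℝ) 1)) :=
    fun hg => (hg.comp (Continuous.prodMk_right t)).continuousOn.integrableOn_compact isCompact_Icc
  have hmain := hasDerivAt_integral_Icc_of_contDiff he t
  have hval : ∫ x in Set.Icc (0 : Fin d → ℝ) 1, pdt e (t, x)
      = -(2 * ν) * ∫ x in Set.Icc (0 : Fin d → ℝ) 1, n (t, x) * ∑ i : Fin d, ∑ j : Fin d,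
        ((pdx i (fun r => u r j) (t, x) + pdx j (fun r => u r i) (t, x)) / 2) ^ 2 := by
    simp only [hkey]
    rw [integral_add, integral_sum_pdx_eq_zero hd F hF hFper, add_zero, integral_const_mul]
    · exact (hint (g := fun q => n q * ∑ i : Fin d, ∑ j : Fin d,
        ((pdx i (fun r => u r j) q + pdx j (fun r => u r i) q) / 2) ^ 2)
        (hn.continuous.mul (continuous_finsetSum _ fun i _ => continuous_finsetSum _ fun j _ =>
          (((hX j i).continuous.add (hX i j).continuous).div_const 2).pow 2))).const_mul _
    · exact hint (g := fun q => ∑ j, pdx j (F j) q)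
        (continuous_finsetSum _ fun j _ => hcpd j (hF j))
  rw [hval] at hmain
  subst he_def hm_def
  exact hmain
end

section
/- (Bresch–Desjardins entropy identity) Let d ≥ 1, ν, ε > 0, γ > 1, and let H_c : ℝ → ℝ be C² and p_c : ℝ → ℝ be C¹ with p_c'(s) = s H_c''(s) for all s > 0. Let n : ℝ × ℝ^d → ℝ and u : ℝ × ℝ^d → ℝ^d be C^∞, ℤ^d-periodic in x, with n(t,x) > 0 everywhere, satisfying pointwise the continuity equation ∂_t n + div(n u) = 0 and the momentum equation ∂_t (n u_i) + Σ_j ∂_j (n u_j u_i) + ∂_i ( n^γ + p_c(n) ) − 2 ε² n ∂_i( Δ√n / √n ) = 2 ν Σ_j ∂_j ( n D(u)_{ij} ) for each i. Then for every t, the function t ↦ ∫_{T^d} ( (n/2) |u + ν ∇ log n|² + n^γ/(γ−1) + H_c(n) + (2ε² + 2ν²) |∇√n|² ) dx is differentiable with derivative − ν ∫_{T^d} ( γ n^{γ−2} |∇n|² + H_c''(n) |∇n|² + ε² n Σ_{i,j}(∂_i∂_j log n)² + n Σ_{i,j} (∂_j u_i)² ) dx. -/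
open MeasureTheory

theorem entropy_production_identity {ι : Type*} [Fintype ι] (n φt G₁ G₂ ν ε : ℝ)
    (a at' u ut : ι → ℝ) (b U c L M : ι → ι → ℝ)
    (hφt : φt = -∑ j, (U j j + u j * a j))
    (hat : ∀ i, at' i = -∑ j, (M i j + U j i * a j + u j * b i j))
    (hb : ∀ i j, b i j = b j i)
    (hut : ∀ i, n * (ut i + ∑ j, u j * U i j) + n * G₂ * (n * a i)
        - ε ^ 2 * n * ∑ j, (c i j + a j * b i j)
        = ν * ∑ j, n * (a j * (U j i + U i j) + M i j + L i j)) :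
    n * φt / 2 * ∑ i, (u i + ν * a i) ^ 2 + n * ∑ i, (u i + ν * a i) * (ut i + ν * at' i)
      + G₁ * (n * φt) + (ε ^ 2 + ν ^ 2) / 2 * ∑ i, (n * φt * a i ^ 2 + 2 * n * a i * at' i)
    = ∑ j, (-(G₂ * (n * a j) * (n * u j) + G₁ * (n * a j * u j + n * U j j))
        + ∑ i, (-((n * a j * u j + n * U j j) / 2 * (u i + ν * a i) ^ 2
              + n * u j * (u i + ν * a i) * (U i j + ν * b i j))
            + ν * ((U i j + ν * b i j) * n * U i j + (u i + ν * a i) * (n * a j) * U i j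
              + (u i + ν * a i) * n * L i j)
            + ε ^ 2 * ((U i j + ν * b i j) * n * b i j + (u i + ν * a i) * (n * a j) * b i j
              + (u i + ν * a i) * n * c i j)
            - (ε ^ 2 + ν ^ 2) * ((n * a j * u j + n * U j j) / 2 * a i ^ 2 + n * u j * a i * b i j)
            - (ε ^ 2 + ν ^ 2) * (b i j * n * U j i + a i * (n * a j) * U j i + a i * n * M i j)))
      - ν * (G₂ * ∑ i, (n * a i) ^ 2 + ε ^ 2 * n * ∑ i, ∑ j, b i j ^ 2
        + n * ∑ i, ∑ j, U i j ^ 2) := by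
  have hut' : ∀ i, n * ut i = ∑ j, (-(n * u j * U i j) + ε ^ 2 * n * (c i j + a j * b i j)
      + ν * n * (a j * (U j i + U i j) + M i j + L i j)) - n * G₂ * (n * a i) := by
    intro i
    have := hut i
    simp only [Finset.sum_add_distrib, Finset.mul_sum, mul_add, Finset.sum_neg_distrib] at this ⊢
    simp only [← mul_assoc] at this ⊢
    linarith
  have hswap : ∑ i, ∑ j, b i j * U i j = ∑ i, ∑ j, b i j * U j i := by
    rw [Finset.sum_comm]
    exact Finset.sum_congr rfl fun i _ => Finset.sum_congr rfl fun j _ => by rw [hb]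
  have hlin : ∀ (α β δ : ℝ) (x y z : ι → ℝ), ∑ j, (α * x j + β * y j + δ * z j)
      = α * ∑ j, x j + β * ∑ j, y j + δ * ∑ j, z j := fun α β δ x y z => by
    simp only [Finset.sum_add_distrib, Finset.mul_sum]
  have hrow : ∀ i, n * φt / 2 * (u i + ν * a i) ^ 2
        + (u i + ν * a i) * (n * ut i + ν * n * at' i)
        + (ε ^ 2 + ν ^ 2) / 2 * (n * φt * a i ^ 2 + 2 * n * a i * at' i)
      = -((u i + ν * a i) * (n * G₂ * (n * a i))) + ∑ j,
        ((-(n / 2 * (u i + ν * a i) ^ 2) - (ε ^ 2 + ν ^ 2) / 2 * n * a i ^ 2)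
            * (U j j + u j * a j)
          + (u i + ν * a i) * (-(n * u j * U i j) + ε ^ 2 * n * (c i j + a j * b i j)
            + ν * n * (a j * (U j i + U i j) + M i j + L i j))
          + (-((u i + ν * a i) * (ν * n)) - (ε ^ 2 + ν ^ 2) * n * a i)
            * (M i j + U j i * a j + u j * b i j)) := by
    intro i
    rw [hlin, hut' i, hat i, hφt]
    ring
  have hlhs : n * φt / 2 * ∑ i, (u i + ν * a i) ^ 2
      + n * ∑ i, (u i + ν * a i) * (ut i + ν * at' i)
      + G₁ * (n * φt) + (ε ^ 2 + ν ^ 2) / 2 * ∑ i, (n * φt * a i ^ 2 + 2 * n * a i * at' i)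
      = G₁ * (n * φt) + ∑ i, (n * φt / 2 * (u i + ν * a i) ^ 2
        + (u i + ν * a i) * (n * ut i + ν * n * at' i)
        + (ε ^ 2 + ν ^ 2) / 2 * (n * φt * a i ^ 2 + 2 * n * a i * at' i)) := by
    rw [add_right_comm (_ + _), add_comm _ (G₁ * (n * φt)), Finset.mul_sum, Finset.mul_sum,
      Finset.mul_sum, ← Finset.sum_add_distrib, ← Finset.sum_add_distrib]
    exact congrArg _ (Finset.sum_congr rfl fun i _ => by ring)
  have hsplit : ∀ (s : ι → ℝ) (f : ι → ι → ℝ), ∑ j, (s j + ∑ i, f i j)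
      = ∑ j, s j + ∑ i, ∑ j, f i j := fun s f => by
    rw [Finset.sum_add_distrib, Finset.sum_comm]
  have hsingle : G₁ * (n * -∑ j, (U j j + u j * a j))
        + ∑ i, -((u i + ν * a i) * (n * G₂ * (n * a i)))
      = ∑ j, -(G₂ * (n * a j) * (n * u j) + G₁ * (n * a j * u j + n * U j j))
        - ν * (G₂ * ∑ i, (n * a i) ^ 2) := by
    simp only [← Finset.sum_neg_distrib, Finset.mul_sum]
    rw [← Finset.sum_add_distrib, ← Finset.sum_sub_distrib]
    exact Finset.sum_congr rfl fun i _ => by ring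
  have hdouble : ∀ (S A : ℝ) (f g : ι → ι → ℝ), (∀ i j, f i j = g i j
        + (ε ^ 2 + ν ^ 2) * n * (b i j * U j i) - (ε ^ 2 + ν ^ 2) * n * (b i j * U i j)
        - ν * (ε ^ 2 * n) * b i j ^ 2 - ν * n * U i j ^ 2) →
      S - ν * A + ∑ i, ∑ j, f i j = S + ∑ i, ∑ j, g i j
        - ν * (A + ε ^ 2 * n * ∑ i, ∑ j, b i j ^ 2 + n * ∑ i, ∑ j, U i j ^ 2) := by
    intro S A f g h
    simp only [h, Finset.sum_add_distrib, Finset.sum_sub_distrib, ← Finset.mul_sum, hswap]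
    ring
  rw [hlhs, Finset.sum_congr rfl fun i _ => hrow i, Finset.sum_add_distrib, hsplit, hφt,
    ← add_assoc, hsingle]
  exact hdouble _ _ _ _ fun i j => by ring

section DirectionalDerivative

variable {E : Type*} [NormedAddCommGroup E] [NormedSpace ℝ E]

/-- The derivative of `f` in the direction `v`. -/
noncomputable def dirDeriv (v : E) (f : E → ℝ) (p : E) : ℝ := fderiv ℝ f p v

theorem dirDeriv_add {v : E} {f g : E → ℝ} (hf : Differentiable ℝ f) (hg : Differentiable ℝ g) :
    dirDeriv v (fun q => f q + g q) = fun q => dirDeriv v f q + dirDeriv v g q := by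
  ext p; simp [dirDeriv, fderiv_fun_add (hf p) (hg p)]

theorem dirDeriv_sub {v : E} {f g : E → ℝ} (hf : Differentiable ℝ f) (hg : Differentiable ℝ g) :
    dirDeriv v (fun q => f q - g q) = fun q => dirDeriv v f q - dirDeriv v g q := by
  ext p; simp [dirDeriv, fderiv_fun_sub (hf p) (hg p)]

theorem dirDeriv_neg {v : E} {f : E → ℝ} :
    dirDeriv v (fun q => -f q) = fun q => -dirDeriv v f q := by
  ext p; simp [dirDeriv, fderiv_fun_neg]

theorem dirDeriv_mul {v : E} {f g : E → ℝ} (hf : Differentiable ℝ f) (hg : Differentiable ℝ g) :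
    dirDeriv v (fun q => f q * g q) = fun q => dirDeriv v f q * g q + f q * dirDeriv v g q := by
  ext p; simp [dirDeriv, fderiv_fun_mul (hf p) (hg p)]; ring

theorem dirDeriv_const_mul {v : E} {f : E → ℝ} (hf : Differentiable ℝ f) (c : ℝ) :
    dirDeriv v (fun q => c * f q) = fun q => c * dirDeriv v f q := by
  ext p; simp [dirDeriv, fderiv_const_mul (hf p)]

theorem dirDeriv_div_const {v : E} {f : E → ℝ} (hf : Differentiable ℝ f) (c : ℝ) :
    dirDeriv v (fun q => f q / c) = fun q => dirDeriv v f q / c := by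
  simp only [div_eq_inv_mul]; exact dirDeriv_const_mul hf _

theorem dirDeriv_sq {v : E} {f : E → ℝ} (hf : Differentiable ℝ f) :
    dirDeriv v (fun q => f q ^ 2) = fun q => 2 * f q * dirDeriv v f q := by
  simp only [sq]; rw [dirDeriv_mul hf hf]; ext p; ring

theorem dirDeriv_sum {v : E} {ι : Type*} {s : Finset ι} {f : ι → E → ℝ}
    (hf : ∀ i, Differentiable ℝ (f i)) :
    dirDeriv v (fun q => ∑ i ∈ s, f i q) = fun q => ∑ i ∈ s, dirDeriv v (f i) q := by
  ext p; simp [dirDeriv, fderiv_fun_sum fun i _ => hf i p]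

theorem dirDeriv_comp {v : E} {g : ℝ → ℝ} {f : E → ℝ} {g' : ℝ} {p : E}
    (hg : HasDerivAt g g' (f p)) (hf : DifferentiableAt ℝ f p) :
    dirDeriv v (fun q => g (f q)) p = g' * dirDeriv v f p := by
  have := (hg.comp_hasFDerivAt p hf.hasFDerivAt).fderiv
  simp only [dirDeriv]
  rw [show (fun q => g (f q)) = g ∘ f from rfl, this]
  simp

theorem ContDiff.dirDeriv {f : E → ℝ} (hf : ContDiff ℝ (⊤ : ℕ∞) f) (v : E) :
    ContDiff ℝ (⊤ : ℕ∞) (dirDeriv v f) :=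
  (hf.fderiv_right (m := (⊤ : ℕ∞)) (by norm_cast)).clm_apply contDiff_const

theorem continuous_dirDeriv {f : E → ℝ} (hf : ContDiff ℝ 1 f) (v : E) :
    Continuous (dirDeriv v f) :=
  (hf.continuous_fderiv one_ne_zero).clm_apply continuous_const

theorem dirDeriv_comm {f : E → ℝ} (hf : ContDiff ℝ (⊤ : ℕ∞) f) (v w : E) :
    dirDeriv v (dirDeriv w f) = dirDeriv w (dirDeriv v f) := by
  have hd : Differentiable ℝ (fderiv ℝ f) :=
    (hf.fderiv_right (m := (⊤ : ℕ∞)) (by norm_cast)).differentiable (by simp)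
  have key : ∀ a b : E, ∀ p, dirDeriv a (dirDeriv b f) p = fderiv ℝ (fderiv ℝ f) p a b := by
    intro a b p
    change fderiv ℝ (fun q => fderiv ℝ f q b) p a = _
    rw [fderiv_clm_apply (hd p) (differentiableAt_const b)]
    simp
  have hsymm : ∀ p, IsSymmSndFDerivAt ℝ f p := fun p =>
    hf.contDiffAt.isSymmSndFDerivAt (by simpa using WithTop.coe_le_coe.2 (le_top (a := (2 : ℕ∞))))
  ext p
  rw [key, key, hsymm p v w]

end DirectionalDerivative

section Periodic

variable {d : ℕ}

/-- The basis vector of `ℝ × ℝ^d` in the `i`-th spatial direction. -/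
abbrev spaceDir (i : Fin d) : ℝ × (Fin d → ℝ) := (0, Pi.single i 1)

/-- The basis vector of `ℝ × ℝ^d` in the time direction. -/
abbrev timeDir (d : ℕ) : ℝ × (Fin d → ℝ) := (1, 0)

theorem pdx_eq_dirDeriv (i : Fin d) : pdx i = dirDeriv (spaceDir i) := rfl

theorem pdt_eq_dirDeriv : pdt = dirDeriv (timeDir d) := rfl

/-- `ℤ^d`-periodicity in the space variable. -/
def SpacePeriodic (f : ℝ × (Fin d → ℝ) → ℝ) : Prop :=
  ∀ (z : Fin d → ℤ) (t : ℝ) (x : Fin d → ℝ), f (t, x + fun i => (z i : ℝ)) = f (t, x)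

theorem SpacePeriodic.dirDeriv {f : ℝ × (Fin d → ℝ) → ℝ} (hf : SpacePeriodic f)
    (v : ℝ × (Fin d → ℝ)) : SpacePeriodic (dirDeriv v f) := by
  intro z t x
  have h : (fun q => f (q + ((0, fun i => (z i : ℝ)) : ℝ × (Fin d → ℝ)))) = f := by
    ext ⟨s, y⟩
    simpa using hf z s y
  have h' := fderiv_comp_add_right (𝕜 := ℝ) (f := f) (x := (t, x))
    ((0, fun i => (z i : ℝ)) : ℝ × (Fin d → ℝ))
  rw [h] at h'
  simp only [_root_.dirDeriv, h']
  simp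

theorem integral_Icc_divergence_eq_zero (F : Fin d → ℝ × (Fin d → ℝ) → ℝ)
    (hF : ∀ j, ContDiff ℝ 1 (F j)) (hper : ∀ j, SpacePeriodic (F j)) (t : ℝ) :
    ∫ x in Set.Icc (0 : Fin d → ℝ) 1, ∑ j, pdx j (F j) (t, x) = 0 := by
  rcases d with _ | k
  · simp
  have hderiv : ∀ j (x : Fin (k + 1) → ℝ), HasFDerivAt (fun y => F j (t, y))
      ((fderiv ℝ (F j) (t, x)).comp (ContinuousLinearMap.inr ℝ ℝ (Fin (k + 1) → ℝ))) x :=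
    fun j x => (((hF j).differentiable one_ne_zero (t, x)).hasFDerivAt).comp x
      (hasFDerivAt_prodMk_right t x)
  have h := integral_divergence_of_hasFDerivAt_off_countable' (0 : Fin (k + 1) → ℝ) 1
    (by intro i; simp) (fun j y => F j (t, y))
    (fun j x => (fderiv ℝ (F j) (t, x)).comp (ContinuousLinearMap.inr ℝ ℝ (Fin (k + 1) → ℝ)))
    ∅ Set.countable_empty
    (fun j x _ => (hderiv j x).continuousAt.continuousWithinAt)
    (fun x _ j => hderiv j x) ?_
  · have hface : ∀ (j : Fin (k + 1)) (x : Fin k → ℝ),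
        F j (t, j.insertNth (1 : ℝ) x) = F j (t, j.insertNth (0 : ℝ) x) := by
      intro j x
      rw [← hper j (Pi.single j 1) t (j.insertNth (0 : ℝ) x)]
      congr 2
      ext i
      rcases Fin.eq_self_or_eq_succAbove j i with rfl | ⟨l, rfl⟩
      · simp
      · simp [Fin.succAbove_ne]
    simp only [Pi.one_apply, Pi.zero_apply, hface, sub_self, Finset.sum_const_zero] at h
    simpa [pdx] using h
  · apply Continuous.integrableOn_Icc
    refine continuous_finsetSum _ fun j _ => ?_
    simp only [ContinuousLinearMap.comp_apply, ContinuousLinearMap.inr_apply]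
    exact (continuous_dirDeriv (hF j) _).comp (by fun_prop : Continuous fun x => (t, x))

theorem hasDerivAt_integral_Icc {f : ℝ × (Fin d → ℝ) → ℝ} (hf : ContDiff ℝ 1 f) (t : ℝ) :
    HasDerivAt (fun s => ∫ x in Set.Icc (0 : Fin d → ℝ) 1, f (s, x))
      (∫ x in Set.Icc (0 : Fin d → ℝ) 1, pdt f (t, x)) t := by
  have hcont : Continuous (pdt f) := continuous_dirDeriv hf _
  obtain ⟨C, hC⟩ := ((isCompact_Icc (a := t - 1) (b := t + 1)).prod
    (isCompact_Icc (a := (0 : Fin d → ℝ)) (b := 1))).exists_bound_of_continuousOn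
    hcont.continuousOn
  have hslice : ∀ s : ℝ, Continuous fun x : Fin d → ℝ => (s, x) := fun s => by fun_prop
  refine (hasDerivAt_integral_of_dominated_loc_of_deriv_le (bound := fun _ => C)
    (F' := fun s x => pdt f (s, x))
    (Icc_mem_nhds (sub_one_lt t) (lt_add_one t)) (.of_forall fun s => ?_) ?_ ?_ ?_ ?_ ?_).2
  · exact (hf.continuous.comp (hslice s)).aestronglyMeasurable
  · exact (hf.continuous.comp (hslice t)).integrableOn_Icc
  · exact (hcont.comp (hslice t)).aestronglyMeasurable
  · exact (ae_restrict_iff' measurableSet_Icc).2 (.of_forall fun x hx s hs => hC (s, x) ⟨hs, hx⟩)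
  · exact integrableOn_const (isCompact_Icc.measure_lt_top).ne
  · refine .of_forall fun x s _ => ?_
    exact ((hf.differentiable one_ne_zero (s, x)).hasFDerivAt).comp_hasDerivAt s
      ((hasDerivAt_id s).prodMk (hasDerivAt_const s x))

end Periodic

section BalanceLaw

variable {d : ℕ}

/-- The flux of the Bresch–Desjardins entropy, written in terms of the density `n`, its logarithm
`φ`, the velocity `u` and the derivative `g₁` of the internal energy with respect to the density. -/
noncomputable def entropyFlux (ν ε : ℝ) (n φ g₁ : ℝ × (Fin d → ℝ) → ℝ)
    (u : Fin d → ℝ × (Fin d → ℝ) → ℝ) (j : Fin d) (q : ℝ × (Fin d → ℝ)) : ℝ :=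
  -(g₁ q * (n q * u j q))
    + ∑ i, (-(n q * u j q / 2 * (u i q + ν * pdx i φ q) ^ 2)
      + ν * ((u i q + ν * pdx i φ q) * n q * pdx j (u i) q)
      + ε ^ 2 * ((u i q + ν * pdx i φ q) * n q * pdx j (pdx i φ) q)
      - (ε ^ 2 + ν ^ 2) * (n q * u j q / 2 * pdx i φ q ^ 2)
      - (ε ^ 2 + ν ^ 2) * (pdx i φ q * n q * pdx i (u j) q))

/-- The Bresch–Desjardins entropy density, with internal energy `g`. -/
noncomputable def entropyDensity (ν ε : ℝ) (n φ g : ℝ × (Fin d → ℝ) → ℝ)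
    (u : Fin d → ℝ × (Fin d → ℝ) → ℝ) (q : ℝ × (Fin d → ℝ)) : ℝ :=
  n q / 2 * ∑ i, (u i q + ν * pdx i φ q) ^ 2 + g q
    + (ε ^ 2 + ν ^ 2) / 2 * ∑ i, n q * pdx i φ q ^ 2

theorem contDiff_entropyFlux (ν ε : ℝ) {n φ g₁ : ℝ × (Fin d → ℝ) → ℝ}
    {u : Fin d → ℝ × (Fin d → ℝ) → ℝ} (hn : ContDiff ℝ (⊤ : ℕ∞) n) (hφ : ContDiff ℝ (⊤ : ℕ∞) φ)
    (hu : ∀ i, ContDiff ℝ (⊤ : ℕ∞) (u i)) (hg₁ : ContDiff ℝ 1 g₁) (j : Fin d) :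
    ContDiff ℝ 1 (entropyFlux ν ε n φ g₁ u j) := by
  have h1 : ∀ {f : ℝ × (Fin d → ℝ) → ℝ}, ContDiff ℝ (⊤ : ℕ∞) f → ContDiff ℝ 1 f :=
    fun h => h.of_le (by norm_cast)
  have hn1 := h1 hn
  have hu1 := fun i => h1 (hu i)
  have hφx := fun i => h1 (hφ.dirDeriv (spaceDir i))
  have hφxx := fun i j => h1 ((hφ.dirDeriv (spaceDir i)).dirDeriv (spaceDir j))
  have hux := fun i j => h1 ((hu i).dirDeriv (spaceDir j))
  unfold entropyFlux
  simp only [pdx_eq_dirDeriv]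
  fun_prop

theorem contDiff_entropyDensity (ν ε : ℝ) {n φ g : ℝ × (Fin d → ℝ) → ℝ}
    {u : Fin d → ℝ × (Fin d → ℝ) → ℝ} (hn : ContDiff ℝ (⊤ : ℕ∞) n) (hφ : ContDiff ℝ (⊤ : ℕ∞) φ)
    (hu : ∀ i, ContDiff ℝ (⊤ : ℕ∞) (u i)) (hg : ContDiff ℝ 1 g) :
    ContDiff ℝ 1 (entropyDensity ν ε n φ g u) := by
  have h1 : ∀ {f : ℝ × (Fin d → ℝ) → ℝ}, ContDiff ℝ (⊤ : ℕ∞) f → ContDiff ℝ 1 f :=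
    fun h => h.of_le (by norm_cast)
  have hn1 := h1 hn
  have hu1 := fun i => h1 (hu i)
  have hφx := fun i => h1 (hφ.dirDeriv (spaceDir i))
  unfold entropyDensity
  simp only [pdx_eq_dirDeriv]
  fun_prop

theorem spacePeriodic_entropyFlux (ν ε : ℝ) {n φ g₁ : ℝ × (Fin d → ℝ) → ℝ}
    {u : Fin d → ℝ × (Fin d → ℝ) → ℝ} (hn : SpacePeriodic n) (hφ : SpacePeriodic φ)
    (hu : ∀ i, SpacePeriodic (u i)) (hg₁ : SpacePeriodic g₁) (j : Fin d) :
    SpacePeriodic (entropyFlux ν ε n φ g₁ u j) := by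
  intro z t x
  simp only [entropyFlux, pdx_eq_dirDeriv, hn z, hg₁ z, hu _ z, hφ.dirDeriv _ z,
    (hφ.dirDeriv _).dirDeriv _ z, (hu _).dirDeriv _ z]

theorem pdt_entropyDensity (ν ε : ℝ) {n φ g g₁ g₂ : ℝ × (Fin d → ℝ) → ℝ}
    {u : Fin d → ℝ × (Fin d → ℝ) → ℝ} (hn : ContDiff ℝ (⊤ : ℕ∞) n) (hφ : ContDiff ℝ (⊤ : ℕ∞) φ)
    (hu : ∀ i, ContDiff ℝ (⊤ : ℕ∞) (u i)) (hg : ContDiff ℝ 1 g) (hg₁ : ContDiff ℝ 1 g₁)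
    (hnφ : ∀ v, dirDeriv v n = fun q => n q * dirDeriv v φ q)
    (hgn : ∀ v p, dirDeriv v g p = g₁ p * dirDeriv v n p)
    (hg₁n : ∀ v p, dirDeriv v g₁ p = g₂ p * dirDeriv v n p)
    (hcont : ∀ p, pdt φ p = -∑ j, (pdx j (u j) p + u j p * pdx j φ p))
    (hmom : ∀ p i, n p * (pdt (u i) p + ∑ j, u j p * pdx j (u i) p)
        + n p * g₂ p * (n p * pdx i φ p)
        - ε ^ 2 * n p * ∑ j, (pdx j (pdx j (pdx i φ)) p + pdx j φ p * pdx j (pdx i φ) p)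
        = ν * ∑ j, n p * (pdx j φ p * (pdx i (u j) p + pdx j (u i) p)
          + pdx j (pdx i (u j)) p + pdx j (pdx j (u i)) p)) (p : ℝ × (Fin d → ℝ)) :
    pdt (entropyDensity ν ε n φ g u) p
      = ∑ j, pdx j (entropyFlux ν ε n φ g₁ u j) p
        - ν * (g₂ p * ∑ i, (n p * pdx i φ p) ^ 2
          + ε ^ 2 * n p * ∑ i, ∑ j, pdx i (pdx j φ) p ^ 2
          + n p * ∑ i, ∑ j, pdx j (u i) p ^ 2) := by
  have hd : ∀ {f : ℝ × (Fin d → ℝ) → ℝ}, ContDiff ℝ (⊤ : ℕ∞) f → Differentiable ℝ f :=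
    fun h => h.differentiable (by simp)
  have hgd : Differentiable ℝ g := hg.differentiable one_ne_zero
  have hg₁d : Differentiable ℝ g₁ := hg₁.differentiable one_ne_zero
  have hnd := hd hn
  have hud := fun i => hd (hu i)
  have hφd := hd hφ
  have hφx := fun v => hd (hφ.dirDeriv v)
  have hφxx := fun v w => hd ((hφ.dirDeriv v).dirDeriv w)
  have hux := fun i v => hd ((hu i).dirDeriv v)
  have hat : ∀ i, dirDeriv (timeDir d) (dirDeriv (spaceDir i) φ) p
      = -∑ j, (dirDeriv (spaceDir j) (dirDeriv (spaceDir i) (u j)) p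
        + pdx i (u j) p * pdx j φ p + u j p * dirDeriv (spaceDir i) (pdx j φ) p) := by
    intro i
    simp only [pdx_eq_dirDeriv, pdt_eq_dirDeriv] at hcont ⊢
    rw [dirDeriv_comm hφ, funext hcont]
    simp (disch := fun_prop) only [dirDeriv_neg, dirDeriv_sum, dirDeriv_add, dirDeriv_mul]
    simp only [dirDeriv_comm (hu _) (spaceDir i), add_assoc]
  have key := entropy_production_identity (n p) (pdt φ p) (g₁ p) (g₂ p) ν ε
    (fun i => pdx i φ p) (fun i => pdt (pdx i φ) p) (fun i => u i p) (fun i => pdt (u i) p)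
    (fun i j => pdx i (pdx j φ) p) (fun i j => pdx j (u i) p)
    (fun i j => pdx j (pdx j (pdx i φ)) p) (fun i j => pdx j (pdx j (u i)) p)
    (fun i j => pdx j (pdx i (u j)) p) (hcont p) hat
    (fun i j => congrFun (dirDeriv_comm hφ _ _) p)
    (fun i => ?_)
  · have hflux : ∀ j, pdx j (entropyFlux ν ε n φ g₁ u j) p = _ := fun j => by
      unfold entropyFlux
      simp only [pdx_eq_dirDeriv]
      simp (disch := fun_prop) only [dirDeriv_neg, dirDeriv_sum, dirDeriv_add, dirDeriv_sub,
        dirDeriv_const_mul, dirDeriv_mul, dirDeriv_div_const, dirDeriv_sq, hg₁n, hnφ]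
      rfl
    have htime : pdt (entropyDensity ν ε n φ g u) p
        = n p * pdt φ p / 2 * ∑ i, (u i p + ν * pdx i φ p) ^ 2
          + n p / 2 * ∑ i, 2 * (u i p + ν * pdx i φ p) * (pdt (u i) p + ν * pdt (pdx i φ) p)
          + g₁ p * (n p * pdt φ p) + (ε ^ 2 + ν ^ 2) / 2 * ∑ i, (n p * pdt φ p * pdx i φ p ^ 2
            + n p * (2 * pdx i φ p * pdt (pdx i φ) p)) := by
      unfold entropyDensity
      simp only [pdx_eq_dirDeriv, pdt_eq_dirDeriv]
      simp (disch := fun_prop) only [dirDeriv_sum, dirDeriv_add,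
        dirDeriv_const_mul, dirDeriv_mul, dirDeriv_div_const, dirDeriv_sq, hgn, hnφ]
    refine Eq.trans ?_ (key.trans ?_)
    · simp only [htime, mul_assoc, ← Finset.mul_sum]
      simp only [mul_left_comm (n p) 2]
      ring
    · rw [Finset.sum_congr rfl fun j _ => hflux j]
      refine congrArg (· - _) (Finset.sum_congr rfl fun j _ => congrArg _ <|
        Finset.sum_congr rfl fun i _ => ?_)
      simp only [pdx_eq_dirDeriv]
      rw [dirDeriv_comm hφ (spaceDir i)]
      ring
  · rw [← hmom p i]
    simp only [pdx_eq_dirDeriv, dirDeriv_comm hφ (spaceDir i)]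

end BalanceLaw

/-- Bresch–Desjardins entropy identity for the quantum Navier–Stokes system:
`t ↦ ∫_{T^d} ( (n/2)|u + ν∇log n|² + n^γ/(γ−1) + H_c(n) + (2ε² + 2ν²)|∇√n|² )` is
differentiable with derivative
`−ν ∫_{T^d} ( γ n^{γ−2}|∇n|² + H_c''(n)|∇n|² + ε² n |∇² log n|² + n |∇u|² )`. -/
theorem bresch_desjardins_entropy (d : ℕ) (hd : 1 ≤ d) (ν ε γ : ℝ)
    (hν : 0 < ν) (hε : 0 < ε) (hγ : 1 < γ)
    (H_c : ℝ → ℝ) (hHc : ContDiff ℝ 2 H_c)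
    (p_c : ℝ → ℝ) (hpc : ContDiff ℝ 1 p_c)
    (hpHc : ∀ s : ℝ, 0 < s → deriv p_c s = s * deriv (deriv H_c) s)
    (n : ℝ × (Fin d → ℝ) → ℝ) (u : ℝ × (Fin d → ℝ) → Fin d → ℝ)
    (hn : ContDiff ℝ (⊤ : ℕ∞) n) (hu : ContDiff ℝ (⊤ : ℕ∞) u)
    (hpos : ∀ p, 0 < n p)
    (hnper : ∀ (z : Fin d → ℤ) (t : ℝ) (x : Fin d → ℝ),
      n (t, x + fun i => (z i : ℝ)) = n (t, x))
    (huper : ∀ (z : Fin d → ℤ) (t : ℝ) (x : Fin d → ℝ),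
      u (t, x + fun i => (z i : ℝ)) = u (t, x))
    (hcont : ∀ p, pdt n p + ∑ j : Fin d, pdx j (fun q => n q * u q j) p = 0)
    (hmom : ∀ (p : ℝ × (Fin d → ℝ)) (i : Fin d),
      pdt (fun q => n q * u q i) p
        + (∑ j : Fin d, pdx j (fun q => n q * u q j * u q i) p)
        + pdx i (fun q => n q ^ γ + p_c (n q)) p
        - 2 * ε ^ 2 * n p *
            pdx i (fun q =>
              (∑ j : Fin d, pdx j (pdx j (fun r => Real.sqrt (n r))) q)
                / Real.sqrt (n q)) p
        = 2 * ν * ∑ j : Fin d,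
            pdx j (fun q => n q *
              ((pdx i (fun r => u r j) q + pdx j (fun r => u r i) q) / 2)) p) :
    ∀ t : ℝ,
      HasDerivAt
        (fun s => ∫ x in Set.Icc (0 : Fin d → ℝ) 1,
          (n (s, x) / 2 *
              (∑ i : Fin d,
                (u (s, x) i + ν * pdx i (fun q => Real.log (n q)) (s, x)) ^ 2)
            + n (s, x) ^ γ / (γ - 1)
            + H_c (n (s, x))
            + (2 * ε ^ 2 + 2 * ν ^ 2) *
                ∑ i : Fin d, (pdx i (fun q => Real.sqrt (n q)) (s, x)) ^ 2))
        (-ν * ∫ x in Set.Icc (0 : Fin d → ℝ) 1,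
          (γ * n (t, x) ^ (γ - 2) * (∑ i : Fin d, (pdx i n (t, x)) ^ 2)
            + deriv (deriv H_c) (n (t, x)) * (∑ i : Fin d, (pdx i n (t, x)) ^ 2)
            + ε ^ 2 * n (t, x) *
                ∑ i : Fin d, ∑ j : Fin d,
                  (pdx i (pdx j (fun q => Real.log (n q))) (t, x)) ^ 2
            + n (t, x) *
                ∑ i : Fin d, ∑ j : Fin d, (pdx j (fun q => u q i) (t, x)) ^ 2)) t := by
  intro t
  have hn0 : ∀ p, n p ≠ 0 := fun p => (hpos p).ne'
  set φ : ℝ × (Fin d → ℝ) → ℝ := fun q => Real.log (n q) with hφ_def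
  set s : ℝ × (Fin d → ℝ) → ℝ := fun q => Real.sqrt (n q) with hs_def
  set v : Fin d → ℝ × (Fin d → ℝ) → ℝ := fun i q => u q i with hv_def
  have hv : ∀ i, ContDiff ℝ (⊤ : ℕ∞) (v i) := fun i => contDiff_pi.1 hu i
  have hφ : ContDiff ℝ (⊤ : ℕ∞) φ := hn.log hn0
  have hs : ContDiff ℝ (⊤ : ℕ∞) s := hn.sqrt hn0
  have hs0 : ∀ p, s p ≠ 0 := fun p => (Real.sqrt_pos.2 (hpos p)).ne'
  have hs_sq : ∀ p, s p ^ 2 = n p := fun p => Real.sq_sqrt (hpos p).le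
  have hd : ∀ {f : ℝ × (Fin d → ℝ) → ℝ}, ContDiff ℝ (⊤ : ℕ∞) f → Differentiable ℝ f :=
    fun h => h.differentiable (by simp)
  have hnd := hd hn
  have hsd := hd hs
  have hvd := fun i => hd (hv i)
  have hφd := hd hφ
  have hφx := fun w => hd (hφ.dirDeriv w)
  have hφxx := fun w w' => hd ((hφ.dirDeriv w).dirDeriv w')
  have hvx := fun i w => hd ((hv i).dirDeriv w)
  have hnφ : ∀ w, dirDeriv w n = fun q => n q * dirDeriv w φ q := fun w => by
    ext p
    rw [hφ_def, dirDeriv_comp (Real.hasDerivAt_log (hn0 p)) (hnd p), mul_inv_cancel_left₀ (hn0 p)]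
  have hsφ : ∀ w, dirDeriv w s = fun q => s q * (dirDeriv w φ q / 2) := fun w => by
    ext p
    have h := hs_sq p
    have h0 := hs0 p
    rw [show dirDeriv w s p = _ from dirDeriv_comp (Real.hasDerivAt_sqrt (hn0 p)) (hnd p), hnφ,
      show Real.sqrt (n p) = s p from rfl]
    beta_reduce
    rw [← h]
    field_simp
  have hquot : (fun q => (∑ j, pdx j (pdx j s) q) / s q)
      = fun q => ∑ j, (pdx j (pdx j φ) q / 2 + pdx j φ q ^ 2 / 4) := by
    ext p
    have h0 := hs0 p
    simp only [pdx_eq_dirDeriv]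
    simp (disch := fun_prop) only [hsφ, dirDeriv_mul, dirDeriv_div_const]
    rw [Finset.sum_div]
    refine Finset.sum_congr rfl fun j _ => ?_
    field_simp
    ring
  have hH' : ContDiff ℝ 1 (deriv H_c) := ContDiff.iterate_deriv' 1 1 hHc
  have hHd : Differentiable ℝ H_c := hHc.differentiable two_ne_zero
  have hH'd : Differentiable ℝ (deriv H_c) := hH'.differentiable one_ne_zero
  have hγ' : γ - 1 ≠ 0 := (sub_pos.2 hγ).ne'
  have hn1 : ContDiff ℝ 1 n := hn.of_le (by norm_cast)
  set g : ℝ × (Fin d → ℝ) → ℝ := fun q => n q ^ γ / (γ - 1) + H_c (n q) with hg_def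
  set g₁ : ℝ × (Fin d → ℝ) → ℝ :=
    fun q => γ / (γ - 1) * n q ^ (γ - 1) + deriv H_c (n q) with hg₁_def
  set g₂ : ℝ × (Fin d → ℝ) → ℝ :=
    fun q => γ * n q ^ (γ - 2) + deriv (deriv H_c) (n q) with hg₂_def
  have hg : ContDiff ℝ 1 g := ((hn1.rpow_const_of_ne hn0).div_const _).add
    ((hHc.of_le one_le_two).comp hn1)
  have hg₁ : ContDiff ℝ 1 g₁ := (contDiff_const.mul (hn1.rpow_const_of_ne hn0)).add
    (hH'.comp hn1)
  have hgn : ∀ w p, dirDeriv w g p = g₁ p * dirDeriv w n p := fun w p => by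
    refine dirDeriv_comp (g := fun x => x ^ γ / (γ - 1) + H_c x) ?_ (hnd p)
    refine HasDerivAt.add ?_ (hHd _).hasDerivAt
    convert! (Real.hasDerivAt_rpow_const (p := γ) (Or.inl (hn0 p))).div_const (γ - 1) using 1
    ring
  have hg₁n : ∀ w p, dirDeriv w g₁ p = g₂ p * dirDeriv w n p := fun w p => by
    refine dirDeriv_comp (g := fun x => γ / (γ - 1) * x ^ (γ - 1) + deriv H_c x) ?_ (hnd p)
    refine HasDerivAt.add ?_ (hH'd _).hasDerivAt
    convert! (Real.hasDerivAt_rpow_const (p := γ - 1) (Or.inl (hn0 p))).const_mul (γ / (γ - 1))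
      using 1
    rw [show γ - 1 - 1 = γ - 2 by ring]
    field_simp
  have hpress : ∀ i p, pdx i (fun q => n q ^ γ + p_c (n q)) p
      = n p * g₂ p * (n p * pdx i φ p) := fun i p => by
    have hpow : n p ^ (γ - 1) = n p ^ (γ - 2) * n p := by
      rw [← Real.rpow_add_one (hn0 p)]; congr 1; ring
    rw [pdx_eq_dirDeriv, ← congrFun (hnφ (spaceDir i)) p]
    refine dirDeriv_comp (g := fun x => x ^ γ + p_c x) ?_ (hnd p)
    convert! (Real.hasDerivAt_rpow_const (p := γ) (Or.inl (hn0 p))).add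
      (hpc.differentiable one_ne_zero (n p)).hasDerivAt using 1
    rw [hpHc _ (hpos p), hpow]
    ring
  have hcontφ : ∀ p, pdt φ p = -∑ j, (pdx j (v j) p + v j p * pdx j φ p) := fun p => by
    have h := hcont p
    change dirDeriv (timeDir d) n p + ∑ j, dirDeriv (spaceDir j) (fun q => n q * v j q) p = 0 at h
    simp (disch := fun_prop) only [dirDeriv_mul, hnφ] at h
    apply mul_left_cancel₀ (hn0 p)
    rw [mul_neg, Finset.mul_sum]
    refine (eq_neg_of_add_eq_zero_left h).trans (congrArg _ (Finset.sum_congr rfl fun j _ => ?_))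
    simp only [pdx_eq_dirDeriv]
    ring
  have hmomφ : ∀ p i, n p * (pdt (v i) p + ∑ j, v j p * pdx j (v i) p)
      + n p * g₂ p * (n p * pdx i φ p)
      - ε ^ 2 * n p * ∑ j, (pdx j (pdx j (pdx i φ)) p + pdx j φ p * pdx j (pdx i φ) p)
      = ν * ∑ j, n p * (pdx j φ p * (pdx i (v j) p + pdx j (v i) p)
        + pdx j (pdx i (v j)) p + pdx j (pdx j (v i)) p) := fun p i => by
    have h := hmom p i
    rw [hpress, show (fun q => (∑ j : Fin d, pdx j (pdx j (fun r => Real.sqrt (n r))) q)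
      / Real.sqrt (n q)) = _ from hquot] at h
    change dirDeriv (timeDir d) (fun q => n q * v i q) p
      + (∑ j, dirDeriv (spaceDir j) (fun q => n q * v j q * v i q) p) + _ - _ = 2 * ν * ∑ j,
        dirDeriv (spaceDir j) (fun q => n q * ((dirDeriv (spaceDir i) (v j) q
          + dirDeriv (spaceDir j) (v i) q) / 2)) p at h
    have hc := hcontφ p
    simp only [pdx_eq_dirDeriv, pdt_eq_dirDeriv] at h hc ⊢
    simp (disch := fun_prop) only [dirDeriv_mul, dirDeriv_sum, dirDeriv_add, dirDeriv_div_const,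
      dirDeriv_sq, hnφ, hc] at h
    simp only [dirDeriv_comm (hφ.dirDeriv _) (spaceDir i), dirDeriv_comm hφ (spaceDir i)] at h
    have hdrift : ∑ j, ((n p * dirDeriv (spaceDir j) φ p * v j p
          + n p * dirDeriv (spaceDir j) (v j) p) * v i p
          + n p * v j p * dirDeriv (spaceDir j) (v i) p)
        = n p * v i p * ∑ j, (dirDeriv (spaceDir j) (v j) p + v j p * dirDeriv (spaceDir j) φ p)
          + n p * ∑ j, v j p * dirDeriv (spaceDir j) (v i) p := by
      rw [Finset.mul_sum, Finset.mul_sum, ← Finset.sum_add_distrib]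
      exact Finset.sum_congr rfl fun j _ => by ring
    have hquantum : ∑ j, (dirDeriv (spaceDir j) (dirDeriv (spaceDir j)
            (dirDeriv (spaceDir i) φ)) p / 2
          + 2 * dirDeriv (spaceDir j) φ p * dirDeriv (spaceDir j) (dirDeriv (spaceDir i) φ) p / 4)
        = 1 / 2 * ∑ j, (dirDeriv (spaceDir j) (dirDeriv (spaceDir j) (dirDeriv (spaceDir i) φ)) p
          + dirDeriv (spaceDir j) φ p * dirDeriv (spaceDir j) (dirDeriv (spaceDir i) φ) p) := by
      rw [Finset.mul_sum]
      exact Finset.sum_congr rfl fun j _ => by ring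
    have hviscous : ∑ j, (n p * dirDeriv (spaceDir j) φ p
            * ((dirDeriv (spaceDir i) (v j) p + dirDeriv (spaceDir j) (v i) p) / 2)
          + n p * ((dirDeriv (spaceDir j) (dirDeriv (spaceDir i) (v j)) p
            + dirDeriv (spaceDir j) (dirDeriv (spaceDir j) (v i)) p) / 2))
        = 1 / 2 * ∑ j, n p * (dirDeriv (spaceDir j) φ p
            * (dirDeriv (spaceDir i) (v j) p + dirDeriv (spaceDir j) (v i) p)
          + dirDeriv (spaceDir j) (dirDeriv (spaceDir i) (v j)) p
          + dirDeriv (spaceDir j) (dirDeriv (spaceDir j) (v i)) p) := by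
      rw [Finset.mul_sum]
      exact Finset.sum_congr rfl fun j _ => by ring
    linear_combination h - hdrift + 2 * ε ^ 2 * n p * hquantum + 2 * ν * hviscous
  have hnper' : SpacePeriodic n := hnper
  have hφper : SpacePeriodic φ := fun z t x => congrArg Real.log (hnper z t x)
  have hvper : ∀ i, SpacePeriodic (v i) := fun i z t x => congrFun (huper z t x) i
  have hg₁per : SpacePeriodic g₁ := fun z t x => by simp only [hg₁_def, hnper z t x]
  have hF := contDiff_entropyFlux ν ε hn hφ hv hg₁
  have hFper := spacePeriodic_entropyFlux ν ε hnper' hφper hvper hg₁per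
  have hE := contDiff_entropyDensity ν ε hn hφ hv hg
  have hpdt := pdt_entropyDensity ν ε hn hφ hv hg hg₁ hnφ hgn hg₁n hcontφ hmomφ
  have hslice : Continuous fun x : Fin d → ℝ => (t, x) := by fun_prop
  have hdiv : Continuous fun x : Fin d → ℝ =>
      ∑ j, pdx j (entropyFlux ν ε n φ g₁ v j) (t, x) :=
    continuous_finsetSum _ fun j _ => (continuous_dirDeriv (hF j) _).comp hslice
  have hpt : Continuous fun x : Fin d → ℝ => pdt (entropyDensity ν ε n φ g v) (t, x) :=
    (continuous_dirDeriv hE _).comp hslice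
  convert! hasDerivAt_integral_Icc hE t using 1
  · ext r
    congr 1
    ext x
    simp only [entropyDensity, pdx_eq_dirDeriv, hsφ, mul_pow, hs_sq, Finset.mul_sum, hg_def]
    rw [add_assoc (∑ i, _) (_ / _)]
    congr 1
    exact Finset.sum_congr rfl fun i _ => by ring
  · rw [← sub_zero (∫ x in _, pdt _ _), ← integral_Icc_divergence_eq_zero _ hF hFper t,
      ← integral_sub hpt.integrableOn_Icc hdiv.integrableOn_Icc, ← integral_const_mul]
    congr 1
    ext x
    rw [hpdt, sub_sub_cancel_left]
    simp only [pdx_eq_dirDeriv, hnφ, hg₂_def]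
    ring
end
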